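/- Let (Ω,P,π) be a finite irreducible reversible Markov chain, let P_L := (I+P)/2 be its lazy version, and let x,y,z ∈ Ω and t ∈ ℕ. Then P_L^t(x,y)/π(y) = Σ_{k=0}^{t} P[T_{z,y}^x = k, T_y^x ≤ T_z^x]·P_L^{t−k}(y,y)/π(y) + Σ_{k=0}^{t} P[T_{z,y}^x = k, T_y^x > T_z^x]·P_L^{t−k}(z,z)/π(z), and this quantity is at least P[T_{z,y}^x ≤ t]. -/

import Mathlib

open Filter Finset

noncomputable section

variable {V : Type} [Fintype V] [DecidableEq V]

/-- `P` is a row-stochastic matrix. -/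
def IsStoch (P : Matrix V V ℝ) : Prop :=
  (∀ i j, 0 ≤ P i j) ∧ ∀ i, ∑ j, P i j = 1

/-- `π` is a probability vector with full support. -/
def IsProb (π : V → ℝ) : Prop := (∀ i, 0 < π i) ∧ ∑ i, π i = 1

/-- reversibility: `π x * P x y = π y * P y x`. -/
def Rev (P : Matrix V V ℝ) (π : V → ℝ) : Prop := ∀ i j, π i * P i j = π j * P j i

/-- irreducibility -/
def Irred (P : Matrix V V ℝ) : Prop := ∀ i j, ∃ t : ℕ, 0 < (P ^ t) i j

/-- the lazy version `(I + P)/2` of a chain -/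
def lazyM (P : Matrix V V ℝ) : Matrix V V ℝ := (2 : ℝ)⁻¹ • (1 + P)

/-- total variation distance -/
def tvDist (μ ν : V → ℝ) : ℝ := (∑ x, |μ x - ν x|) / 2

/-- worst-case total variation distance from stationarity at time `t` -/
def dTV (P : Matrix V V ℝ) (π : V → ℝ) (t : ℕ) : ℝ := ⨆ x, tvDist ((P ^ t) x) π

/-- the `ε` total-variation mixing time -/
def mixTime (P : Matrix V V ℝ) (π : V → ℝ) (ε : ℝ) : ℕ := sInf {t : ℕ | dTV P π t ≤ ε}

/-- worst-case separation distance at time `t` -/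
def dSep (P : Matrix V V ℝ) (π : V → ℝ) (t : ℕ) : ℝ := 1 - ⨅ x, ⨅ y, ((P ^ t) x y) / π y

/-- the `ε` separation time -/
def sepTime (P : Matrix V V ℝ) (π : V → ℝ) (ε : ℝ) : ℕ := sInf {t : ℕ | dSep P π t ≤ ε}

/-- the heat kernel `H_t = exp (t (P - I))` of the associated continuous-time chain -/
def heatKer (P : Matrix V V ℝ) (t : ℝ) : Matrix V V ℝ :=
  ∑' k : ℕ, (t ^ k / (Nat.factorial k : ℝ)) • ((P - 1) ^ k)

/-- separation distance of the continuous-time chain -/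
def dSepC (P : Matrix V V ℝ) (π : V → ℝ) (t : ℝ) : ℝ := 1 - ⨅ x, ⨅ y, (heatKer P t) x y / π y

/-- the `ε` separation time of the continuous-time chain -/
def sepTimeC (P : Matrix V V ℝ) (π : V → ℝ) (ε : ℝ) : ℝ := sInf {t : ℝ | 0 ≤ t ∧ dSepC P π t ≤ ε}

/-- degree of a vertex -/
def deg (G : SimpleGraph V) (v : V) : ℕ := Nat.card {u // G.Adj v u}

open Classical in
/-- transition matrix of the lazy simple random walk on `G` -/
def walkMat (G : SimpleGraph V) : Matrix V V ℝ :=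
  Matrix.of fun v u => if v = u then 1/2 else if G.Adj v u then 1 / (2 * (deg G v : ℝ)) else 0

/-- stationary distribution of the (lazy) simple random walk on `G` -/
def degSta (G : SimpleGraph V) (v : V) : ℝ := (deg G v : ℝ) / ∑ u, (deg G u : ℝ)

/-- the `ε` total-variation mixing time of the lazy simple random walk on `G` -/
def tmixG (G : SimpleGraph V) (ε : ℝ) : ℕ := mixTime (walkMat G) (degSta G) ε

/-- the second largest eigenvalue of a reversible transition matrix -/
def lam2 (P : Matrix V V ℝ) : ℝ :=
  sSup {μ : ℝ | μ ≠ 1 ∧ ∃ f : V → ℝ, f ≠ 0 ∧ P.mulVec f = μ • f}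

/-- the relaxation time `1/(1-λ₂)` -/
def trel (P : Matrix V V ℝ) : ℝ := 1 / (1 - lam2 P)

/-- the relaxation time of the lazy simple random walk on `G` -/
def trelG (G : SimpleGraph V) : ℝ := trel (walkMat G)

/-- transition matrix of the lazy random walk on the network with edge weights `w` -/
def wMat (w : V → V → ℝ) : Matrix V V ℝ :=
  Matrix.of fun v u => if v = u then 1/2 else w v u / (2 * ∑ x, w v x)

/-- stationary distribution of the lazy random walk on the network with edge weights `w` -/
def wSta (w : V → V → ℝ) (v : V) : ℝ := (∑ x, w v x) / ∑ u, ∑ x, w u x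

/-- `w` is a valid system of edge weights on the graph `G`: symmetric, positive on edges
and vanishing off the edges. -/
def GoodWeights (G : SimpleGraph V) (w : V → V → ℝ) : Prop :=
  (∀ u v, w u v = w v u) ∧ (∀ u v, G.Adj u v → 0 < w u v) ∧ ∀ u v, ¬ G.Adj u v → w u v = 0

/-- the `ε` total-variation mixing time of the lazy random walk on the weighted network -/
def tmixW (w : V → V → ℝ) (ε : ℝ) : ℕ := mixTime (wMat w) (wSta w) ε

/-- the probability of a discrete trajectory -/
def pathProb (P : Matrix V V ℝ) {k : ℕ} (w : Fin (k+1) → V) : ℝ :=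
  ∏ i : Fin k, P (w i.castSucc) (w i.succ)

/-- `P_x[T_y = k]`: probability that the chain started at `x` first hits `y` at time `k` -/
def firstHit (P : Matrix V V ℝ) (x y : V) (k : ℕ) : ℝ :=
  ∑ w : Fin (k+1) → V,
    if w 0 = x ∧ w (Fin.last k) = y ∧ ∀ i : Fin k, w i.castSucc ≠ y then pathProb P w else 0

/-- the restriction of `P - I` to the complement of `y` -/
def restrQ (P : Matrix V V ℝ) (y : V) : Matrix {w : V // w ≠ y} {w : V // w ≠ y} ℝ :=
  Matrix.of fun a b => P a.1 b.1 - if a = b then 1 else 0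

/-- `exp (t A)` where `A` is the restriction of `P - I` to the complement of `y` -/
def heatRestr (P : Matrix V V ℝ) (y : V) (t : ℝ) :
    Matrix {w : V // w ≠ y} {w : V // w ≠ y} ℝ :=
  ∑' k : ℕ, (t ^ k / (Nat.factorial k : ℝ)) • (restrQ P y ^ k)

/-- `P_x[T_B < r]` for the chain `P`: the probability that the set `B` is hit before time `r` -/
def hitByTime (P : Matrix V V ℝ) (B : Finset V) (x : V) (r : ℕ) : ℝ :=
  ∑ k ∈ Finset.range r, ∑ w : Fin (k+1) → V,
    if w 0 = x ∧ w (Fin.last k) ∈ B ∧ ∀ i : Fin k, w i.castSucc ∉ B then pathProb P w else 0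


/-- `P[T_y^x = k, T_y^x ≤ T_z^x]`: the chain started at `x` first hits `y` at time `k`,
not having visited `z` before time `k`. -/
def hitYBeforeZ (P : Matrix V V ℝ) (x y z : V) (k : ℕ) : ℝ :=
  ∑ w : Fin (k+1) → V,
    if w 0 = x ∧ w (Fin.last k) = y ∧ ∀ i : Fin k, w i.castSucc ≠ y ∧ w i.castSucc ≠ z then
      pathProb P w
    else 0

/-- `P[T_z^x = k, T_y^x > T_z^x]`: the chain started at `x` first hits `z` at time `k`,
not having visited `y` up to (and including) time `k`. -/
def hitZStrictlyBeforeY (P : Matrix V V ℝ) (x y z : V) (k : ℕ) : ℝ :=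
  ∑ w : Fin (k+1) → V,
    if w 0 = x ∧ w (Fin.last k) = z ∧ w (Fin.last k) ≠ y ∧
        ∀ i : Fin k, w i.castSucc ≠ z ∧ w i.castSucc ≠ y then
      pathProb P w
    else 0

/-- `P[T_{z,y}^x = k, T_y^x ≤ T_z^x]`, where
`T_{z,y}^x = T_y^x 1{T_y^x ≤ T_z^x} + (T_z^x + T_z^y) 1{T_y^x > T_z^x}` for two independent
copies of the chain started at `x` and at `y`. -/
def probTzyEqAndLe (P : Matrix V V ℝ) (x y z : V) (k : ℕ) : ℝ := hitYBeforeZ P x y z k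

/-- `P[T_{z,y}^x = k, T_y^x > T_z^x]`. -/
def probTzyEqAndGt (P : Matrix V V ℝ) (x y z : V) (k : ℕ) : ℝ :=
  ∑ j ∈ Finset.range (k+1), hitZStrictlyBeforeY P x y z j * firstHit P y z (k - j)

/-- The probability that the chain started at `x` enters the set `B` at time `k`, at the
state `v` (for `v ∈ B`). -/
def entranceProb (P : Matrix V V ℝ) (B : Finset V) (x v : V) (k : ℕ) : ℝ :=
  ∑ w : Fin (k+1) → V,
    if w 0 = x ∧ w (Fin.last k) = v ∧ ∀ i : Fin k, w i.castSucc ∉ B then pathProb P w else 0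

lemma entranceProb_zero (P : Matrix V V ℝ) (B : Finset V) (x v : V) :
    entranceProb P B x v 0 = if x = v then 1 else 0 := by
  unfold entranceProb pathProb
  rw [← (Equiv.funUnique (Fin 1) V).symm.sum_comp]
  simp [Equiv.funUnique, ite_and]

lemma pathProb_cons {W : Type} (P : Matrix W W ℝ) {k : ℕ} (a : W) (w : Fin (k+1) → W) :
    pathProb P (Fin.cons a w : Fin (k+2) → W) = P a (w 0) * pathProb P w := by
  unfold pathProb
  rw [Fin.prod_univ_succ]
  simp

lemma entranceProb_succ (P : Matrix V V ℝ) (B : Finset V) (x v : V) (k : ℕ) :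
    entranceProb P B x v (k+1) =
      if x ∈ B then 0 else ∑ u, P x u * entranceProb P B u v k := by
  have hcons : entranceProb P B x v (k+1) = ∑ a, ∑ w : Fin (k+1) → V,
      if a = x ∧ w (Fin.last k) = v ∧ a ∉ B ∧ ∀ i : Fin k, w i.castSucc ∉ B then
        P a (w 0) * pathProb P w else 0 := by
    unfold entranceProb
    rw [← (Fin.consEquiv fun _ : Fin (k+2) => V).sum_comp, Fintype.sum_prod_type]
    simp [Fin.consEquiv, pathProb_cons, Fin.forall_fin_succ, ← Fin.succ_last]
  rw [hcons, Fintype.sum_eq_single x fun a ha => by simp [ha]]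
  split_ifs with hx
  · simp [hx]
  · simp_rw [entranceProb, Finset.mul_sum]
    rw [Finset.sum_comm]
    refine Finset.sum_congr rfl fun w _ => ?_
    rw [Fintype.sum_eq_single (w 0) fun u hu => by simp [hu.symm]]
    simp [hx]

lemma entranceProb_nonneg {P : Matrix V V ℝ} (hP : ∀ i j, 0 ≤ P i j) (B : Finset V) (x v : V)
    (k : ℕ) : 0 ≤ entranceProb P B x v k := by
  refine Finset.sum_nonneg fun w _ => ?_
  split_ifs
  exacts [Finset.prod_nonneg fun i _ => hP _ _, le_rfl]

/-- Decomposition of the `t`-step transition probability to a state of `B` according to the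
time and place of the first entrance to `B`. -/
lemma pow_apply_eq_sum_entranceProb (P : Matrix V V ℝ) {B : Finset V} {y : V} (hy : y ∈ B)
    (t : ℕ) (x : V) :
    (P ^ t) x y =
      ∑ k ∈ Finset.range (t+1), ∑ v ∈ B, entranceProb P B x v k * (P ^ (t - k)) v y := by
  induction t generalizing x with
  | zero =>
    simp [entranceProb_zero, Matrix.one_apply, hy]
  | succ t ih =>
    rw [Finset.sum_range_succ']
    by_cases hx : x ∈ B
    · simp [entranceProb_succ, entranceProb_zero, hx]
    · simp only [entranceProb_succ, entranceProb_zero, hx, if_false]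
      simp only [ite_mul, one_mul, zero_mul, Finset.sum_ite_eq, hx, if_false, add_zero,
        Nat.add_sub_add_right, pow_succ', Matrix.mul_apply, ih, Finset.mul_sum, Finset.sum_mul]
      rw [Finset.sum_comm]
      refine Finset.sum_congr rfl fun k _ => ?_
      rw [Finset.sum_comm]
      exact Finset.sum_congr rfl fun v _ => Finset.sum_congr rfl fun u _ => by ring

lemma firstHit_eq_entranceProb (P : Matrix V V ℝ) (x y : V) (k : ℕ) :
    firstHit P x y k = entranceProb P {y} x y k := by
  simp [firstHit, entranceProb]

lemma hitYBeforeZ_eq_entranceProb (P : Matrix V V ℝ) (x y z : V) (k : ℕ) :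
    hitYBeforeZ P x y z k = entranceProb P {y, z} x y k := by
  simp [hitYBeforeZ, entranceProb]

lemma hitZStrictlyBeforeY_eq_entranceProb (P : Matrix V V ℝ) (x y z : V) (k : ℕ) :
    hitZStrictlyBeforeY P x y z k = if y = z then 0 else entranceProb P {y, z} x z k := by
  unfold hitZStrictlyBeforeY entranceProb
  split_ifs with h
  · refine Finset.sum_eq_zero fun w _ => if_neg ?_
    rintro ⟨-, h1, h2, -⟩
    exact h2 (h1.trans h.symm)
  · refine Finset.sum_congr rfl fun w _ => if_congr ?_ rfl rfl
    simp only [Finset.mem_insert, Finset.mem_singleton, not_or]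
    constructor
    · rintro ⟨h0, h1, -, h3⟩
      exact ⟨h0, h1, fun i => (h3 i).symm⟩
    · rintro ⟨h0, h1, h3⟩
      exact ⟨h0, h1, fun h2 => h (h2.symm.trans h1), fun i => (h3 i).symm⟩

lemma pow_apply_eq_sum_hit (P : Matrix V V ℝ) (x y z : V) (t : ℕ) :
    (P ^ t) x y =
      (∑ k ∈ Finset.range (t+1), hitYBeforeZ P x y z k * (P ^ (t - k)) y y) +
      ∑ k ∈ Finset.range (t+1), hitZStrictlyBeforeY P x y z k * (P ^ (t - k)) z y := by
  rw [pow_apply_eq_sum_entranceProb P (Finset.mem_insert_self y {z}) t x,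
    ← Finset.sum_add_distrib]
  refine Finset.sum_congr rfl fun k _ => ?_
  rw [hitYBeforeZ_eq_entranceProb, hitZStrictlyBeforeY_eq_entranceProb]
  by_cases h : y = z
  · subst h
    simp
  · simp [h, Finset.sum_pair h]

lemma Rev.diagonal_mul {P : Matrix V V ℝ} {π : V → ℝ} (h : Rev P π) :
    Matrix.diagonal π * P = P.transpose * Matrix.diagonal π := by
  ext i j
  simp [h i j, mul_comm]

lemma Rev.pow {P : Matrix V V ℝ} {π : V → ℝ} (h : Rev P π) (t : ℕ) : Rev (P ^ t) π := by
  have key : Matrix.diagonal π * P ^ t = (P.transpose) ^ t * Matrix.diagonal π :=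
    (SemiconjBy.pow_right (show SemiconjBy _ _ _ from h.diagonal_mul) t)
  intro i j
  have := congrFun (congrFun key i) j
  simpa [← Matrix.transpose_pow, mul_comm] using this

lemma Rev.lazyM {W : Type} [DecidableEq W] {P : Matrix W W ℝ} {π : W → ℝ} (h : Rev P π) :
    Rev (lazyM P) π := by
  intro i j
  have h1 := h i j
  by_cases hij : i = j
  · rw [hij]
  · simp only [_root_.lazyM, Matrix.smul_apply, Matrix.add_apply, Matrix.one_apply, hij,
      Ne.symm hij, if_false, smul_eq_mul]
    linarith

lemma IsStoch.lazyM {P : Matrix V V ℝ} (h : IsStoch P) : IsStoch (lazyM P) := by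
  refine ⟨fun i j => ?_, fun i => ?_⟩
  · have := h.1 i j
    simp only [_root_.lazyM, Matrix.smul_apply, Matrix.add_apply, Matrix.one_apply, smul_eq_mul]
    split_ifs <;> linarith
  · simp only [_root_.lazyM, Matrix.smul_apply, Matrix.add_apply, Matrix.one_apply, smul_eq_mul,
      ← Finset.mul_sum, Finset.sum_add_distrib, h.2, Finset.sum_ite_eq, Finset.mem_univ, if_true]
    norm_num

lemma IsStoch.pow_mulVec_one {P : Matrix V V ℝ} (h : IsStoch P) (t : ℕ) :
    (P ^ t).mulVec 1 = 1 := by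
  induction t with
  | zero => simp
  | succ t ih =>
    have h1 : P.mulVec 1 = 1 := by
      ext i
      simp [Matrix.mulVec, dotProduct, h.2 i]
    rw [pow_succ, ← Matrix.mulVec_mulVec, h1, ih]

lemma posSemidef_diagonal_mul_lazyM {P : Matrix V V ℝ} {π : V → ℝ} (hP : IsStoch P)
    (hπ : ∀ i, 0 ≤ π i) (hrev : Rev P π) : (Matrix.diagonal π * lazyM P).PosSemidef := by
  refine Matrix.PosSemidef.of_dotProduct_mulVec_nonneg ?_ fun f => ?_
  · ext i j
    simpa using (hrev.lazyM j i)
  have hsum : ∑ i, ∑ j, π i * P i j * f i ^ 2 = ∑ i, π i * f i ^ 2 := by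
    refine Finset.sum_congr rfl fun i _ => ?_
    rw [← Finset.sum_mul, ← Finset.mul_sum, hP.2, mul_one]
  have hsum' : ∑ i, ∑ j, π i * P i j * f j ^ 2 = ∑ i, π i * f i ^ 2 := by
    rw [Finset.sum_comm, ← hsum]
    simp_rw [hrev _ _]
  have key : star f ⬝ᵥ (Matrix.diagonal π * lazyM P).mulVec f =
      ∑ i, ∑ j, π i * P i j * (f i + f j) ^ 2 / 4 := by
    have hL : star f ⬝ᵥ (Matrix.diagonal π * lazyM P).mulVec f =
        (∑ i, π i * f i ^ 2) / 2 + (∑ i, ∑ j, π i * P i j * (f i * f j)) / 2 := by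
      simp only [dotProduct, Matrix.mulVec, Matrix.diagonal_mul, lazyM, Matrix.smul_apply,
        Matrix.add_apply, Matrix.one_apply, smul_eq_mul, Pi.star_apply, star_trivial,
        Finset.mul_sum, Finset.sum_div]
      rw [← Finset.sum_add_distrib]
      refine Finset.sum_congr rfl fun i _ => ?_
      have : π i * f i ^ 2 / 2 = ∑ j, if i = j then π i * f i * f j / 2 else 0 := by
        simp; ring
      rw [this, ← Finset.sum_add_distrib]
      refine Finset.sum_congr rfl fun j _ => ?_
      split_ifs <;> ring
    have hR : ∑ i, ∑ j, π i * P i j * (f i + f j) ^ 2 / 4 =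
        (∑ i, ∑ j, π i * P i j * f i ^ 2) / 4 + (∑ i, ∑ j, π i * P i j * f j ^ 2) / 4 +
          (∑ i, ∑ j, π i * P i j * (f i * f j)) / 2 := by
      simp only [Finset.sum_div, ← Finset.sum_add_distrib]
      exact Finset.sum_congr rfl fun i _ => Finset.sum_congr rfl fun j _ => by ring
    rw [hL, hR, hsum, hsum']
    ring
  rw [key]
  exact Finset.sum_nonneg fun i _ => Finset.sum_nonneg fun j _ =>
    div_nonneg (mul_nonneg (mul_nonneg (hπ i) (hP.1 i j)) (sq_nonneg _)) (by norm_num)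

lemma posSemidef_diagonal_mul_lazyM_pow {P : Matrix V V ℝ} {π : V → ℝ} (hP : IsStoch P)
    (hπ : ∀ i, 0 ≤ π i) (hrev : Rev P π) (t : ℕ) :
    (Matrix.diagonal π * lazyM P ^ t).PosSemidef := by
  induction t using Nat.twoStepInduction with
  | zero => simpa using Matrix.PosSemidef.diagonal (d := π) (Pi.le_def.mpr hπ)
  | one => simpa using posSemidef_diagonal_mul_lazyM hP hπ hrev
  | more t ih _ =>
    have h := ih.conjTranspose_mul_mul_same (lazyM P)
    rwa [Matrix.conjTranspose_eq_transpose_of_trivial, ← mul_assoc, ← hrev.lazyM.diagonal_mul,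
      mul_assoc, mul_assoc, ← pow_succ, ← pow_succ'] at h

/-- Return probabilities of a lazy reversible chain are at least the stationary probability. -/
lemma le_lazyM_pow_apply_self {P : Matrix V V ℝ} {π : V → ℝ} (hP : IsStoch P) (hπ : IsProb π)
    (hrev : Rev P π) (t : ℕ) (y : V) : π y ≤ (lazyM P ^ t) y y := by
  have hy := hπ.1 y
  have h := (posSemidef_diagonal_mul_lazyM_pow hP (fun i => (hπ.1 i).le) hrev t)
    |>.dotProduct_mulVec_nonneg (Pi.single y 1 - π y • 1)
  set M := Matrix.diagonal π * lazyM P ^ t with hM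
  have h1 : M.mulVec 1 = π := by
    rw [hM, ← Matrix.mulVec_mulVec, hP.lazyM.pow_mulVec_one]
    ext i
    simp [Matrix.mulVec_diagonal]
  have hcol : 1 ⬝ᵥ M.col y = π y := by
    have : ∀ i, M i y = π y * (lazyM P ^ t) y i := fun i => by
      rw [hM, Matrix.diagonal_mul, hrev.lazyM.pow t i y]
    have h2 := congrFun (hP.lazyM.pow_mulVec_one t) y
    simp only [Matrix.mulVec, dotProduct, Pi.one_apply, mul_one] at h2
    simp [dotProduct, this, ← Finset.mul_sum, h2]
  have htot : (1 : V → ℝ) ⬝ᵥ π = 1 := by simpa [dotProduct] using hπ.2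
  have hyy : M.col y y = π y * (lazyM P ^ t) y y := by simp [hM]
  rw [star_trivial, Matrix.mulVec_sub, Matrix.mulVec_smul, h1, Matrix.mulVec_single_one,
    sub_dotProduct, single_one_dotProduct, smul_dotProduct, dotProduct_sub, hcol,
    dotProduct_smul, htot, Pi.sub_apply, hyy] at h
  simp only [Pi.smul_apply, smul_eq_mul] at h
  have : 0 ≤ π y * ((lazyM P ^ t) y y - π y) := by linarith
  linarith [nonneg_of_mul_nonneg_right this hy]

lemma sum_probTzyEqAndGt_mul (P : Matrix V V ℝ) (x y z : V) (t : ℕ) :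
    ∑ k ∈ Finset.range (t+1), probTzyEqAndGt P x y z k * (P ^ (t - k)) z z =
      ∑ j ∈ Finset.range (t+1), hitZStrictlyBeforeY P x y z j * (P ^ (t - j)) y z := by
  have hz : ∀ s, (P ^ s) y z =
      ∑ i ∈ Finset.range (s+1), firstHit P y z i * (P ^ (s - i)) z z := fun s => by
    simp [firstHit_eq_entranceProb,
      pow_apply_eq_sum_entranceProb P (Finset.mem_singleton_self z) s y]
  simp only [probTzyEqAndGt, Finset.sum_mul, hz, Finset.mul_sum]
  rw [Finset.sum_sigma', Finset.sum_sigma']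
  refine Finset.sum_bij' (fun p _ => ⟨p.2, p.1 - p.2⟩) (fun p _ => ⟨p.1 + p.2, p.1⟩)
    ?_ ?_ ?_ ?_ ?_
  · rintro ⟨k, j⟩ h
    simp only [Finset.mem_sigma, Finset.mem_range] at h ⊢
    omega
  · rintro ⟨j, i⟩ h
    simp only [Finset.mem_sigma, Finset.mem_range] at h ⊢
    omega
  · rintro ⟨k, j⟩ h
    simp only [Finset.mem_sigma, Finset.mem_range] at h
    simp only [Sigma.mk.injEq, heq_eq_eq, and_true]
    omega
  · rintro ⟨j, i⟩ h
    simp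
  · rintro ⟨k, j⟩ h
    simp only [Finset.mem_sigma, Finset.mem_range] at h
    rw [show t - j - (k - j) = t - k by omega]
    ring

lemma probTzyEqAndLe_nonneg {P : Matrix V V ℝ} (hP : ∀ i j, 0 ≤ P i j) (x y z : V) (k : ℕ) :
    0 ≤ probTzyEqAndLe P x y z k := by
  rw [probTzyEqAndLe, hitYBeforeZ_eq_entranceProb]
  exact entranceProb_nonneg hP _ _ _ _

lemma probTzyEqAndGt_nonneg {P : Matrix V V ℝ} (hP : ∀ i j, 0 ≤ P i j) (x y z : V) (k : ℕ) :
    0 ≤ probTzyEqAndGt P x y z k := by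
  refine Finset.sum_nonneg fun j _ => mul_nonneg ?_ ?_
  · rw [hitZStrictlyBeforeY_eq_entranceProb]
    split_ifs
    exacts [le_rfl, entranceProb_nonneg hP _ _ _ _]
  · rw [firstHit_eq_entranceProb]
    exact entranceProb_nonneg hP _ _ _ _

lemma pow_apply_div_eq_sum_probTzy {P : Matrix V V ℝ} {π : V → ℝ} (hπ : ∀ i, 0 < π i)
    (hrev : Rev P π) (x y z : V) (t : ℕ) :
    (P ^ t) x y / π y =
      (∑ k ∈ Finset.range (t+1), probTzyEqAndLe P x y z k * (P ^ (t - k)) y y / π y) +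
      ∑ k ∈ Finset.range (t+1), probTzyEqAndGt P x y z k * (P ^ (t - k)) z z / π z := by
  rw [← Finset.sum_div, ← Finset.sum_div, sum_probTzyEqAndGt_mul,
    pow_apply_eq_sum_hit P x y z t, add_div]
  congr 1
  rw [Finset.sum_div, Finset.sum_div]
  refine Finset.sum_congr rfl fun j _ => ?_
  rw [div_eq_div_iff (hπ y).ne' (hπ z).ne']
  linear_combination hitZStrictlyBeforeY P x y z j * hrev.pow (t - j) z y

/-- **Lemma 3.2 (i).** For a finite irreducible reversible chain, all `x, y, z` and `t`,
`P_L^t(x,y)/π(y) = Σ_{k ≤ t} P[T_{z,y}^x = k, T_y^x ≤ T_z^x] P_L^{t-k}(y,y)/π(y)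
 + Σ_{k ≤ t} P[T_{z,y}^x = k, T_y^x > T_z^x] P_L^{t-k}(z,z)/π(z) ≥ P[T_{z,y}^x ≤ t]`. -/
theorem lazy_kernel_hitting_decomposition
    {N : ℕ} (P : Matrix (Fin N) (Fin N) ℝ) (π : Fin N → ℝ)
    (hP : IsStoch P) (hπ : IsProb π) (hrev : Rev P π) (hirr : Irred P)
    (x y z : Fin N) (t : ℕ) :
    ((lazyM P ^ t) x y / π y =
      (∑ k ∈ Finset.range (t+1),
        probTzyEqAndLe (lazyM P) x y z k * (lazyM P ^ (t - k)) y y / π y) +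
      (∑ k ∈ Finset.range (t+1),
        probTzyEqAndGt (lazyM P) x y z k * (lazyM P ^ (t - k)) z z / π z)) ∧
    (∑ k ∈ Finset.range (t+1),
        (probTzyEqAndLe (lazyM P) x y z k + probTzyEqAndGt (lazyM P) x y z k)) ≤
      (lazyM P ^ t) x y / π y := by
  have hdec := pow_apply_div_eq_sum_probTzy hπ.1 hrev.lazyM x y z t
  refine ⟨hdec, ?_⟩
  rw [hdec, Finset.sum_add_distrib]
  have hret : ∀ (v : Fin N) (s : ℕ) (a : ℝ), 0 ≤ a → a ≤ a * (lazyM P ^ s) v v / π v := by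
    intro v s a ha
    rw [le_div_iff₀ (hπ.1 v)]
    exact mul_le_mul_of_nonneg_left (le_lazyM_pow_apply_self hP hπ hrev s v) ha
  exact add_le_add
    (Finset.sum_le_sum fun k _ => hret y _ _ (probTzyEqAndLe_nonneg hP.lazyM.1 x y z k))
    (Finset.sum_le_sum fun k _ => hret z _ _ (probTzyEqAndGt_nonneg hP.lazyM.1 x y z k))

end
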